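/- arXiv:2408.12019 — 3 statements merged into one kernel-verified Lean document; each statement's English description precedes it below -/
import Mathlib

section
/- Let p be a prime and 2 ≤ ℓ ≤ k with ℓ ≤ n and k ≤ p^n − 1. Then ⌊(k−1)/(ℓ−1)⌋ · Θ_n^{(ℓ,ℓ)} ≤ Θ_n^{(k,ℓ)} ≤ (k−ℓ+1) · Ind_p(n,k,ℓ). -/
open Finset

/-- A finite set of nonzero vectors of `ℚ_p^n` is orthogonal if every linear
combination of its elements realizes the equality case of the ultrametric
inequality (here `ℚ_p^n` carries the sup norm, and we compare nonnegative-real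
valued norms so that the empty supremum makes sense). -/
def OrthSet (p : ℕ) [Fact p.Prime] {n : ℕ} (F : Finset (Fin n → ℚ_[p])) : Prop :=
  ∀ lam : (Fin n → ℚ_[p]) → ℚ_[p],
    ‖∑ u ∈ F, lam u • u‖₊ = F.sup fun u => ‖lam u • u‖₊

/-- A finite set `S ⊆ ℚ_p^n \ {0}` is `(k,ℓ)`-orthogonal if every `E ⊆ S` of size
`k` contains an orthogonal subset of size `ℓ`. -/
def OrthKL (p : ℕ) [Fact p.Prime] {n : ℕ} (k ℓ : ℕ)
    (S : Finset (Fin n → ℚ_[p])) : Prop :=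
  (0 : Fin n → ℚ_[p]) ∉ S ∧
    ∀ E ⊆ S, E.card = k → ∃ F ⊆ E, F.card = ℓ ∧ OrthSet p F

/-- `Θ_n^{(k,ℓ)}`: the maximum size of a finite `(k,ℓ)`-orthogonal subset of
`ℚ_p^n \ {0}`. -/
noncomputable def Theta (p : ℕ) [Fact p.Prime] (n k ℓ : ℕ) : ℕ :=
  sSup {m | ∃ S : Finset (Fin n → ℚ_[p]), OrthKL p k ℓ S ∧ S.card = m}
/-- A finite set `S ⊆ F^n \ {0}` is `(k,ℓ)`-independent if every subset `X ⊆ S` of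
size `k` spans a subspace of dimension at least `ℓ`. -/
def IndKL (F : Type*) [Field F] (n k ℓ : ℕ) (S : Finset (Fin n → F)) : Prop :=
  (0 : Fin n → F) ∉ S ∧
    ∀ X ⊆ S, X.card = k →
      ℓ ≤ Module.finrank F ↥(Submodule.span F (↑X : Set (Fin n → F)))

/-- `Ind_q(n,k,ℓ)`: the maximum size of a `(k,ℓ)`-independent subset of
`F^n \ {0}`, where `F` is a field (with `q` elements). -/
noncomputable def IndMax (F : Type*) [Field F] (n k ℓ : ℕ) : ℕ :=
  sSup {m | ∃ S : Finset (Fin n → F), IndKL F n k ℓ S ∧ S.card = m}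

/-- Every nonzero vector of `ℚ_p^n` has a multiple which is a primitive vector of `ℤ_p^n`. -/
lemma exists_smul_eq_primitive (p : ℕ) [Fact p.Prime] {n : ℕ} {v : Fin n → ℚ_[p]} (hv : v ≠ 0) :
    ∃ (c : ℚ_[p]) (w : Fin n → ℤ_[p]), (c • v = fun i => (w i : ℚ_[p])) ∧ ‖c • v‖ = 1 := by
  have hpos : 0 < ‖v‖ := norm_pos_iff.2 hv
  obtain ⟨j, -⟩ := Function.ne_iff.1 hv
  have : Nonempty (Fin n) := ⟨j⟩
  obtain ⟨i, hi⟩ := Finite.exists_max fun i => ‖v i‖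
  have hvi : ‖v‖ = ‖v i‖ :=
    le_antisymm ((pi_norm_le_iff_of_nonneg (norm_nonneg _)).2 hi) (norm_le_pi_norm v i)
  have h1 : ‖(v i)⁻¹ • v‖ = 1 := by
    rw [norm_smul, norm_inv, ← hvi, inv_mul_cancel₀ hpos.ne']
  exact ⟨(v i)⁻¹, fun j => ⟨((v i)⁻¹ • v) j, (norm_le_pi_norm _ j).trans h1.le⟩, rfl, h1⟩

lemma PadicInt.toZMod_eq_zero_iff_norm_lt_one {p : ℕ} [Fact p.Prime] (x : ℤ_[p]) :
    PadicInt.toZMod x = 0 ↔ ‖(x : ℚ_[p])‖ < 1 := by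
  rw [← RingHom.mem_ker, PadicInt.ker_toZMod, IsLocalRing.mem_maximalIdeal,
    PadicInt.mem_nonunits, PadicInt.norm_def]

/-- Reduction modulo `p` of primitive multiples sends orthogonal sets to independent ones. -/
lemma exists_reduction (p : ℕ) [Fact p.Prime] (n : ℕ) :
    ∃ r : (Fin n → ℚ_[p]) → (Fin n → ZMod p), ∀ F : Finset (Fin n → ℚ_[p]),
      0 ∉ F → OrthSet p F → LinearIndepOn (ZMod p) r (F : Set (Fin n → ℚ_[p])) := by
  classical
  have key : ∀ v : Fin n → ℚ_[p], ∃ (c : ℚ_[p]) (w : Fin n → ℤ_[p]),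
      v ≠ 0 → (c • v = fun i => (w i : ℚ_[p])) ∧ ‖c • v‖ = 1 := fun v => by
    by_cases hv : v = 0
    · exact ⟨0, 0, fun h => absurd hv h⟩
    · obtain ⟨c, w, h⟩ := exists_smul_eq_primitive p hv
      exact ⟨c, w, fun _ => h⟩
  choose c w hcw using key
  refine ⟨fun v i => PadicInt.toZMod (w v i), fun F hF0 hF => ?_⟩
  rw [linearIndepOn_finset_iff]
  intro a ha u hu
  have hne : ∀ v ∈ F, v ≠ 0 := fun v hv h => hF0 (h ▸ hv)
  choose A hA using fun v => ZMod.ringHom_surjective (PadicInt.toZMod (p := p)) (a v)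
  have hsum : ∑ v ∈ F, ((A v : ℚ_[p]) * c v) • v =
      fun i => ((∑ v ∈ F, A v * w v i : ℤ_[p]) : ℚ_[p]) := by
    ext i
    rw [Finset.sum_apply, PadicInt.coe_sum]
    refine Finset.sum_congr rfl fun v hv => ?_
    rw [mul_smul, (hcw v (hne v hv)).1]
    simp
  have hlt : ‖∑ v ∈ F, ((A v : ℚ_[p]) * c v) • v‖ < 1 := by
    rw [hsum, pi_norm_lt_iff one_pos]
    intro i
    rw [← PadicInt.toZMod_eq_zero_iff_norm_lt_one]
    simpa [hA] using congrFun ha i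
  have hle := Finset.le_sup (f := fun v => ‖((A v : ℚ_[p]) * c v) • v‖₊) hu
  rw [← hF fun v => (A v : ℚ_[p]) * c v] at hle
  rw [← hA u, PadicInt.toZMod_eq_zero_iff_norm_lt_one]
  have hle' : ‖((A u : ℚ_[p]) * c u) • u‖ ≤ ‖∑ v ∈ F, ((A v : ℚ_[p]) * c v) • v‖ := hle
  rw [mul_smul, norm_smul, (hcw u (hne u hu)).2, mul_one] at hle'
  exact hle'.trans_lt hlt

lemma indMax_bddAbove (F : Type*) [Field F] [Finite F] (n k ℓ : ℕ) :
    BddAbove {m | ∃ S : Finset (Fin n → F), IndKL F n k ℓ S ∧ S.card = m} := by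
  have := Fintype.ofFinite (Fin n → F)
  refine ⟨Fintype.card (Fin n → F), ?_⟩
  rintro _ ⟨S, -, rfl⟩
  exact S.card_le_univ

lemma OrthKL.of_card_lt {p : ℕ} [Fact p.Prime] {n k ℓ : ℕ} {S : Finset (Fin n → ℚ_[p])}
    (h0 : 0 ∉ S) (hS : S.card < k) : OrthKL p k ℓ S :=
  ⟨h0, fun _ hE hk => absurd (hk ▸ Finset.card_le_card hE) hS.not_ge⟩

lemma IndKL.of_card_lt {F : Type*} [Field F] {n k ℓ : ℕ} {S : Finset (Fin n → F)}
    (h0 : 0 ∉ S) (hS : S.card < k) : IndKL F n k ℓ S :=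
  ⟨h0, fun _ hE hk => absurd (hk ▸ Finset.card_le_card hE) hS.not_ge⟩

lemma le_indMax_of_le {p : ℕ} [Fact p.Prime] {n k ℓ m : ℕ} (hm : m < k) (hk : m ≤ p ^ n - 1) :
    m ≤ IndMax (ZMod p) n k ℓ := by
  classical
  have hcard : (Finset.univ.erase (0 : Fin n → ZMod p)).card = p ^ n - 1 := by
    simp [Finset.card_erase_of_mem, ZMod.card]
  obtain ⟨S, hS, hSm⟩ := Finset.exists_subset_card_eq (hcard ▸ hk)
  exact le_csSup (indMax_bddAbove _ n k ℓ)
    ⟨S, .of_card_lt (fun h => by simpa using hS h) (hSm ▸ hm), hSm⟩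

lemma OrthKL.card_le_of_le {p : ℕ} [Fact p.Prime] {n k ℓ : ℕ} {S : Finset (Fin n → ℚ_[p])}
    (hS : OrthKL p k ℓ S) (hℓ : 2 ≤ ℓ) (hkℓ : ℓ ≤ k) (hkS : k ≤ S.card) :
    S.card ≤ (k - ℓ + 1) * IndMax (ZMod p) n k ℓ := by
  classical
  obtain ⟨r, hr⟩ := exists_reduction p n
  have hrank : ∀ E ⊆ S, E.card = k →
      ℓ ≤ Module.finrank (ZMod p) (Submodule.span (ZMod p) (E.image r : Set (Fin n → ZMod p))) := by
    intro E hE hEk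
    obtain ⟨F, hFE, hFc, hF⟩ := hS.2 E hE hEk
    have hli := hr F (fun h => hS.1 (hE (hFE h))) hF
    rw [← hFc, ← Fintype.card_coe F]
    refine (finrank_span_eq_card hli).symm.le.trans (Submodule.finrank_mono (Submodule.span_mono ?_))
    rintro _ ⟨x, rfl⟩
    exact Finset.mem_image_of_mem r (hFE x.2)
  have hne : 0 ∉ S.image r := by
    intro h
    obtain ⟨v, hv, hv0⟩ := Finset.mem_image.1 h
    have hli := hr {v} (fun h0 => hS.1 (Finset.mem_singleton.1 h0 ▸ hv)) fun lam => by simp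
    exact hli.ne_zero (by simp) hv0
  have hind : IndKL (ZMod p) n k ℓ (S.image r) := by
    refine ⟨hne, fun X hX hXk => ?_⟩
    obtain ⟨E, hES, hinj, rfl⟩ :=
      Finset.exists_subset_injOn_image_eq_of_surjOn (f := r) (S : Set _) X fun x hx => by
        simpa using hX hx
    exact hrank E (Finset.coe_subset.1 hES) (by rw [← hXk, Finset.card_image_of_injOn hinj])
  refine (Finset.card_le_mul_card_image S (k - ℓ + 1) fun a _ => ?_).trans
    (Nat.mul_le_mul_left _ (le_csSup (indMax_bddAbove _ n k ℓ) ⟨_, hind, rfl⟩))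
  by_contra! hlt
  obtain ⟨T, hT, hTc⟩ := Finset.exists_subset_card_eq (Nat.succ_le_of_lt hlt)
  obtain ⟨E, hTE, hES, hEk⟩ := Finset.exists_subsuperset_card_eq
    (hT.trans (Finset.filter_subset _ _)) (by omega : T.card ≤ k) hkS
  have hsub : E.image r ⊆ insert a ((E \ T).image r) := by
    intro x hx
    obtain ⟨e, he, rfl⟩ := Finset.mem_image.1 hx
    by_cases heT : e ∈ T
    · simp [(Finset.mem_filter.1 (hT heT)).2]
    · exact Finset.mem_insert_of_mem (Finset.mem_image_of_mem r (by simp [he, heT]))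
  have h1 := (hrank E hES hEk).trans (finrank_span_finset_le_card _)
  have h2 := (Finset.card_le_card hsub).trans (Finset.card_insert_le _ _)
  have h3 := Finset.card_image_le (s := E \ T) (f := r)
  have h4 := Finset.card_sdiff_add_card_eq_card hTE
  omega

lemma theta_bddAbove (p : ℕ) [Fact p.Prime] (n : ℕ) {k ℓ : ℕ} (hℓ : 2 ≤ ℓ) (hkℓ : ℓ ≤ k) :
    BddAbove {m | ∃ S : Finset (Fin n → ℚ_[p]), OrthKL p k ℓ S ∧ S.card = m} := by
  refine ⟨max k ((k - ℓ + 1) * IndMax (ZMod p) n k ℓ), ?_⟩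
  rintro _ ⟨S, hS, rfl⟩
  rcases le_total k S.card with h | h
  · exact le_max_of_le_right (hS.card_le_of_le hℓ hkℓ h)
  · exact le_max_of_le_left h

lemma theta_nonempty (p : ℕ) [Fact p.Prime] (n k ℓ : ℕ) (hk : 0 < k) :
    {m | ∃ S : Finset (Fin n → ℚ_[p]), OrthKL p k ℓ S ∧ S.card = m}.Nonempty :=
  ⟨0, ∅, .of_card_lt (by simp) (by simpa), rfl⟩

/-- Scaling the elements of an orthogonal set by scalars that keep them distinct preserves
orthogonality. -/
lemma OrthSet.image_smul {p : ℕ} [Fact p.Prime] {n : ℕ} [DecidableEq (Fin n → ℚ_[p])]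
    {F : Finset (Fin n → ℚ_[p])} (hF : OrthSet p F) (c : (Fin n → ℚ_[p]) → ℚ_[p])
    (hinj : Set.InjOn (fun u => c u • u) F) : OrthSet p (F.image fun u => c u • u) := by
  intro lam
  rw [Finset.sum_image hinj, Finset.sup_image]
  have h := hF fun u => lam (c u • u) * c u
  simpa only [mul_smul, Function.comp_def] using h

lemma OrthSet.mono {p : ℕ} [Fact p.Prime] {n : ℕ} {F G : Finset (Fin n → ℚ_[p])}
    (hG : OrthSet p G) (h : F ⊆ G) : OrthSet p F := by
  classical
  intro lam
  have := hG fun u => if u ∈ F then lam u else 0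
  rw [← Finset.sum_subset h fun x _ hx => by simp [hx]] at this
  rw [Finset.sum_congr rfl fun x hx => by rw [if_pos hx]] at this
  rw [this]
  refine le_antisymm (Finset.sup_le fun u _ => ?_) (Finset.sup_le fun u hu => ?_)
  · by_cases hu : u ∈ F
    · simpa [hu] using Finset.le_sup (f := fun u => ‖lam u • u‖₊) hu
    · simp [hu]
  · simpa [hu] using
      Finset.le_sup (f := fun u => ‖(if u ∈ F then lam u else 0) • u‖₊) (h hu)

lemma OrthSet.eq_of_smul_eq_smul {p : ℕ} [Fact p.Prime] {n : ℕ} {F : Finset (Fin n → ℚ_[p])}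
    (hF : OrthSet p F) {u v : Fin n → ℚ_[p]} (hu : u ∈ F) (hv : v ∈ F) (hu0 : u ≠ 0)
    {a b : ℚ_[p]} (ha : a ≠ 0) (h : a • u = b • v) : u = v := by
  classical
  by_contra huv
  have h2 : OrthSet p {u, v} :=
    hF.mono (Finset.insert_subset hu (Finset.singleton_subset_iff.2 hv))
  have h3 := h2 fun x => if x = u then a else -b
  rw [Finset.sum_pair huv, if_pos rfl, if_neg (Ne.symm huv), h] at h3
  have h4 := Finset.le_sup (f := fun x => ‖(if x = u then a else -b) • x‖₊)
    (Finset.mem_insert_self u {v})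
  rw [← h3] at h4
  simp [ha, hu0] at h4

/-- Replacing each vector of a large `(ℓ,ℓ)`-orthogonal set by `t` of its multiples. -/
lemma OrthKL.exists_mul_card {p : ℕ} [Fact p.Prime] {n k ℓ t : ℕ} {S : Finset (Fin n → ℚ_[p])}
    (hS : OrthKL p ℓ ℓ S) (hℓ : 2 ≤ ℓ) (hℓS : ℓ ≤ S.card) (ht : t * (ℓ - 1) < k) :
    ∃ T : Finset (Fin n → ℚ_[p]), OrthKL p k ℓ T ∧ T.card = t * S.card := by
  classical
  have hp0 : (p : ℚ_[p]) ≠ 0 := by exact_mod_cast (Fact.out : p.Prime).ne_zero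
  have hne : ∀ v ∈ S, v ≠ 0 := fun v hv h => hS.1 (h ▸ hv)
  have hprop : ∀ u ∈ S, ∀ v ∈ S, ∀ i j : ℕ,
      (p : ℚ_[p]) ^ i • u = (p : ℚ_[p]) ^ j • v → u = v := by
    intro u hu v hv i j h
    obtain ⟨E, huv, hES, hEc⟩ := Finset.exists_subsuperset_card_eq
      (Finset.insert_subset hu (Finset.singleton_subset_iff.2 hv))
      (Finset.card_le_two.trans hℓ) hℓS
    obtain ⟨F, hFE, hFc, hF⟩ := hS.2 E hES hEc
    obtain rfl := Finset.eq_of_subset_of_card_le hFE (hEc.trans hFc.symm).le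
    exact hF.eq_of_smul_eq_smul (huv (by simp)) (huv (by simp)) (hne u hu) (pow_ne_zero i hp0) h
  let f : ℕ × (Fin n → ℚ_[p]) → (Fin n → ℚ_[p]) := fun x => (p : ℚ_[p]) ^ x.1 • x.2
  have hf : Set.InjOn f (Finset.range t ×ˢ S : Finset _) := by
    rintro ⟨i, u⟩ hu ⟨j, v⟩ hv h
    rw [Finset.mem_coe, Finset.mem_product] at hu hv
    obtain rfl := hprop u hu.2 v hv.2 i j h
    have hij := smul_left_injective ℚ_[p] (hne u hu.2) h
    have hpow : ((p ^ i : ℕ) : ℚ_[p]) = (p ^ j : ℕ) := by exact_mod_cast hij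
    rw [Nat.pow_right_injective (Fact.out : p.Prime).two_le (Nat.cast_injective hpow)]
  refine ⟨(Finset.range t ×ˢ S).image f, ⟨fun h0 => ?_, fun E hE hEk => ?_⟩, ?_⟩
  · obtain ⟨⟨i, u⟩, hu, h⟩ := Finset.mem_image.1 h0
    exact smul_ne_zero (pow_ne_zero i hp0) (hne u (Finset.mem_product.1 hu).2) h
  · obtain ⟨D, hD, rfl⟩ := Finset.subset_image_iff.1 hE
    have hDS : D.image Prod.snd ⊆ S := by
      intro u hu
      obtain ⟨x, hx, rfl⟩ := Finset.mem_image.1 hu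
      exact (Finset.mem_product.1 (hD hx)).2
    have hDk : D.card = k := by
      rw [← hEk, Finset.card_image_of_injOn (hf.mono (Finset.coe_subset.2 hD))]
    have hfib : D.card ≤ t * (D.image Prod.snd).card := by
      refine Finset.card_le_mul_card_image D t fun u _ => ?_
      rw [← Finset.card_range t]
      refine Finset.card_le_card_of_injOn Prod.fst (fun x hx => ?_) fun x hx y hy hxy => ?_
      · exact (Finset.mem_product.1 (hD (Finset.mem_filter.1 hx).1)).1
      · exact Prod.ext hxy
          ((Finset.mem_filter.1 hx).2.trans (Finset.mem_filter.1 hy).2.symm)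
    have hℓD : ℓ ≤ (D.image Prod.snd).card := by
      by_contra! hlt
      have := Nat.mul_le_mul_left t (Nat.le_sub_one_of_lt hlt)
      omega
    obtain ⟨G, hGD, hGc⟩ := Finset.exists_subset_card_eq hℓD
    obtain ⟨F, hFG, hFc, hF⟩ := hS.2 G (hGD.trans hDS) hGc
    have hidx : ∀ u, ∃ i : ℕ, u ∈ F → (i, u) ∈ D := fun u => by
      by_cases hu : u ∈ F
      · obtain ⟨⟨i, v⟩, hx, rfl⟩ := Finset.mem_image.1 (hGD (hFG hu))
        exact ⟨i, fun _ => hx⟩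
      · exact ⟨0, fun h => absurd h hu⟩
    choose i hi using hidx
    have hinj : Set.InjOn (fun u => (p : ℚ_[p]) ^ i u • u) F := fun u hu v hv h =>
      hprop u (hDS (hGD (hFG hu))) v (hDS (hGD (hFG hv))) _ _ h
    refine ⟨F.image fun u => (p : ℚ_[p]) ^ i u • u, fun x hx => ?_, ?_,
      hF.image_smul (fun u => (p : ℚ_[p]) ^ i u) hinj⟩
    · obtain ⟨u, hu, rfl⟩ := Finset.mem_image.1 hx
      exact Finset.mem_image_of_mem f (hi u hu)
    · rw [Finset.card_image_of_injOn hinj, hFc]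
  · rw [Finset.card_image_of_injOn hf, Finset.card_product, Finset.card_range]

theorem stmt7 (p : ℕ) [Fact p.Prime] (n k ℓ : ℕ)
    (hℓ : 2 ≤ ℓ) (hkℓ : ℓ ≤ k) (hℓn : ℓ ≤ n) (hk : k ≤ p ^ n - 1) :
    ((k - 1) / (ℓ - 1)) * Theta p n ℓ ℓ ≤ Theta p n k ℓ ∧
    Theta p n k ℓ ≤ (k - ℓ + 1) * IndMax (ZMod p) n k ℓ := by
  have ht : (k - 1) / (ℓ - 1) * (ℓ - 1) ≤ k - 1 := Nat.div_mul_le_self _ _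
  constructor
  · obtain ⟨S, hS, hSc⟩ := Nat.sSup_mem (theta_nonempty p n ℓ ℓ (by omega))
      (theta_bddAbove p n hℓ le_rfl)
    rw [Theta, ← hSc]
    rcases le_or_gt ℓ S.card with hle | hlt
    · obtain ⟨T, hT, hTc⟩ := hS.exists_mul_card (k := k) hℓ hle
        (t := (k - 1) / (ℓ - 1)) (by omega)
      exact le_csSup (theta_bddAbove p n hℓ hkℓ) ⟨T, hT, hTc⟩
    · have : Nonempty (Fin n) := ⟨⟨0, by omega⟩⟩
      obtain ⟨T, hT, hTc⟩ := (Set.finite_singleton (0 : Fin n → ℚ_[p])).infinite_compl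
        |>.exists_subset_card_eq ((k - 1) / (ℓ - 1) * S.card)
      refine le_csSup (theta_bddAbove p n hℓ hkℓ) ⟨T, .of_card_lt (fun h => hT h rfl) ?_, hTc⟩
      have := Nat.mul_le_mul_left ((k - 1) / (ℓ - 1)) (Nat.le_sub_one_of_lt hlt)
      omega
  · refine csSup_le (theta_nonempty p n k ℓ (by omega)) ?_
    rintro _ ⟨S, hS, rfl⟩
    rcases le_or_gt k S.card with hle | hlt
    · exact hS.card_le_of_le hℓ hkℓ hle
    · exact (le_indMax_of_le hlt (by omega)).trans (Nat.le_mul_of_pos_left _ (by omega))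
end

section
/- Let p be a prime and 3 ≤ ℓ ≤ n. Then Θ_n^{(ℓ,ℓ)} < Δ_n^{(ℓ,ℓ)}. -/
open Finset

/-- Two vectors `u, v ∈ ℚ_p^n` are (ultrametrically) orthogonal if every linear
combination realizes the equality case of the ultrametric inequality
(here `ℚ_p^n` carries the sup norm). -/
def Orth2 (p : ℕ) [Fact p.Prime] {n : ℕ} (u v : Fin n → ℚ_[p]) : Prop :=
  ∀ a b : ℚ_[p], ‖a • u + b • v‖ = max ‖a • u‖ ‖b • v‖

/-- A finite set of vectors is weakly orthogonal if any two distinct vectors in it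
are orthogonal. -/
def WeaklyOrthSet (p : ℕ) [Fact p.Prime] {n : ℕ} (S : Finset (Fin n → ℚ_[p])) : Prop :=
  ∀ u ∈ S, ∀ v ∈ S, u ≠ v → Orth2 p u v

/-- A finite set `S ⊆ ℚ_p^n \ {0}` is `(k,ℓ)`-weakly orthogonal if every `E ⊆ S` of
size `k` contains a weakly orthogonal subset of size `ℓ`. -/
def WeaklyOrthKL (p : ℕ) [Fact p.Prime] {n : ℕ} (k ℓ : ℕ)
    (S : Finset (Fin n → ℚ_[p])) : Prop :=
  (0 : Fin n → ℚ_[p]) ∉ S ∧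
    ∀ E ⊆ S, E.card = k → ∃ F ⊆ E, F.card = ℓ ∧ WeaklyOrthSet p F

/-- `Δ_n^{(k,ℓ)}`: the maximum size of a finite `(k,ℓ)`-weakly orthogonal subset of
`ℚ_p^n \ {0}`. -/
noncomputable def Delta (p : ℕ) [Fact p.Prime] (n k ℓ : ℕ) : ℕ :=
  sSup {m | ∃ S : Finset (Fin n → ℚ_[p]), WeaklyOrthKL p k ℓ S ∧ S.card = m}

section UltrametricAux

variable {p : ℕ} [Fact p.Prime] {n : ℕ}

theorem exists_smul_norm_eq_one {u : Fin n → ℚ_[p]} (hu : u ≠ 0) :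
    ∃ c : ℚ_[p], ‖c • u‖ = 1 := by
  obtain ⟨j, -⟩ := Function.ne_iff.mp hu
  have : Nonempty (Fin n) := ⟨j⟩
  obtain ⟨i, hi⟩ := Finite.exists_max fun i => ‖u i‖
  have h : ‖u‖ = ‖u i‖ :=
    le_antisymm ((pi_norm_le_iff_of_nonneg (norm_nonneg _)).2 hi) (norm_le_pi_norm u i)
  refine ⟨(u i)⁻¹, ?_⟩
  rw [norm_smul, norm_inv, ← h, inv_mul_cancel₀ (norm_ne_zero_iff.2 hu)]

theorem max_norm_add_norm_left (x y : Fin n → ℚ_[p]) :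
    max ‖x + y‖ ‖x‖ = max ‖x‖ ‖y‖ := by
  have h₁ := IsUltrametricDist.norm_add_le_max x y
  have h₂ := IsUltrametricDist.norm_add_le_max (x + y) (-x)
  rw [norm_neg, add_neg_cancel_comm] at h₂
  exact le_antisymm (max_le h₁ (le_max_left _ _)) (max_le (le_max_right _ _) h₂)

theorem Orth2.symm {u v : Fin n → ℚ_[p]} (h : Orth2 p u v) : Orth2 p v u := fun a b => by
  rw [add_comm, max_comm, h b a]

theorem Orth2.ne {u v : Fin n → ℚ_[p]} (h : Orth2 p u v) (hu : u ≠ 0) : u ≠ v := by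
  rintro rfl
  have := h 1 (-1)
  simp only [one_smul, neg_smul, add_neg_cancel, norm_zero, norm_neg, max_self] at this
  exact hu (norm_eq_zero.1 this.symm)

theorem Orth2.add_smul_left {u v : Fin n → ℚ_[p]} (h : Orth2 p u v) {c d : ℚ_[p]}
    (hcd : ‖c • u‖ = ‖d • v‖) : Orth2 p (c • u + d • v) u := by
  intro a b
  have e : a • (c • u + d • v) + b • u = (a * c + b) • u + (a * d) • v := by module
  have e' : (a * c + b) • u = a • c • u + b • u := by module
  have hw : ‖c • u + d • v‖ = ‖c • u‖ := by rw [h, ← hcd, max_self]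
  rw [e, h, e', mul_smul a d v, norm_smul a (d • v), ← hcd, ← norm_smul,
    max_norm_add_norm_left, norm_smul a (c • u + d • v), hw, ← norm_smul]

theorem OrthSet.subset {F G : Finset (Fin n → ℚ_[p])} (hF : OrthSet p F) (hG : G ⊆ F) :
    OrthSet p G := by
  classical
  intro lam
  have h := hF fun u => if u ∈ G then lam u else 0
  have e₁ : ∑ u ∈ F, (if u ∈ G then lam u else 0) • u = ∑ u ∈ G, lam u • u := by
    simp only [ite_smul, zero_smul, ← Finset.sum_filter, Finset.filter_mem_eq_inter,
      Finset.inter_eq_right.2 hG]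
  have e₂ : (F.sup fun u => ‖(if u ∈ G then lam u else 0) • u‖₊) =
      G.sup fun u => ‖lam u • u‖₊ := by
    refine le_antisymm (Finset.sup_le fun u _ => ?_) (Finset.sup_le fun u hu => ?_)
    · by_cases hu : u ∈ G
      · simpa [hu] using Finset.le_sup (f := fun u => ‖lam u • u‖₊) hu
      · simp [hu]
    · simpa [hu] using
        Finset.le_sup (f := fun u => ‖(if u ∈ G then lam u else 0) • u‖₊) (hG hu)
  rw [← e₁, h, e₂]

theorem OrthSet.norm_triple [DecidableEq (Fin n → ℚ_[p])] {u v x : Fin n → ℚ_[p]}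
    (h : OrthSet p {u, v, x}) (huv : u ≠ v) (hux : u ≠ x) (hvx : v ≠ x) (a b e : ℚ_[p]) :
    ‖a • u + b • v + e • x‖ = max (max ‖a • u‖ ‖b • v‖) ‖e • x‖ := by
  have := h fun y => if y = u then a else if y = v then b else e
  have := congrArg NNReal.toReal this
  simpa [huv, hux, hvx, huv.symm, hux.symm, hvx.symm, add_assoc, max_assoc,
    -NNReal.coe_inj] using this

theorem OrthSet.orth2_of_mem {F : Finset (Fin n → ℚ_[p])} (h : OrthSet p F)
    {u v : Fin n → ℚ_[p]} (hu : u ∈ F) (hv : v ∈ F) (huv : u ≠ v) : Orth2 p u v := by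
  classical
  intro a b
  have h' : OrthSet p {u, v} := h.subset (by grind)
  have := congrArg NNReal.toReal (h' fun y => if y = u then a else b)
  simpa [huv, huv.symm, -NNReal.coe_inj] using this

theorem OrthSet.orth2_add {u v x : Fin n → ℚ_[p]} {F : Finset (Fin n → ℚ_[p])}
    (h : OrthSet p F) (hu : u ∈ F) (hv : v ∈ F) (hx : x ∈ F)
    (huv : u ≠ v) (hux : u ≠ x) (hvx : v ≠ x) (c d : ℚ_[p]) :
    Orth2 p (c • u + d • v) x := by
  classical
  intro a b
  have h' : OrthSet p {u, v, x} := h.subset (by grind)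
  have e : a • (c • u + d • v) = (a * c) • u + (a * d) • v := by module
  rw [e, h'.norm_triple huv hux hvx, h.orth2_of_mem hu hv huv]

theorem WeaklyOrthSet.card_le {S : Finset (Fin n → ℚ_[p])} (h0 : 0 ∉ S)
    (hS : WeaklyOrthSet p S) : S.card ≤ Fintype.card (Fin n → ZMod p) := by
  have hc (u : S) : ∃ c : ℚ_[p], ‖c • (u : Fin n → ℚ_[p])‖ = 1 :=
    exists_smul_norm_eq_one (ne_of_mem_of_not_mem u.2 h0)
  choose c hc using hc
  have hz (u : S) (i : Fin n) : ∃ z : ℤ_[p], (z : ℚ_[p]) = (c u • (u : Fin n → ℚ_[p])) i :=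
    ⟨⟨_, (norm_le_pi_norm _ i).trans (hc u).le⟩, rfl⟩
  choose z hz using hz
  let r (u : S) (i : Fin n) : ZMod p := PadicInt.toZMod (z u i)
  have hr : Function.Injective r := by
    intro u v huv
    by_contra hne
    have h := hS u u.2 v v.2 (Subtype.coe_injective.ne hne) (c u) (-c v)
    rw [neg_smul, norm_neg, hc, hc, max_self] at h
    refine h.not_lt ((pi_norm_lt_iff one_pos).2 fun i => ?_)
    have hi : PadicInt.toZMod (z u i - z v i) = 0 := by
      rw [map_sub, sub_eq_zero]
      exact congrFun huv i
    rw [← RingHom.mem_ker, PadicInt.ker_toZMod, IsLocalRing.mem_maximalIdeal,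
      PadicInt.mem_nonunits, PadicInt.norm_def, PadicInt.coe_sub, hz, hz] at hi
    rwa [← sub_eq_add_neg, Pi.sub_apply]
  simpa using Fintype.card_le_of_injective r hr

theorem WeaklyOrthKL.weaklyOrthSet {ℓ : ℕ} {S : Finset (Fin n → ℚ_[p])} (hℓ : 2 ≤ ℓ)
    (hS : WeaklyOrthKL p ℓ ℓ S) (hc : ℓ ≤ S.card) : WeaklyOrthSet p S := by
  classical
  intro u hu v hv huv
  obtain ⟨E, huE, hES, hE⟩ := Finset.exists_subsuperset_card_eq
    (show {u, v} ⊆ S by grind) (Finset.card_le_two.trans hℓ) hc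
  obtain ⟨F, hFE, hF, h⟩ := hS.2 E hES hE
  obtain rfl := Finset.eq_of_subset_of_card_le hFE (by omega)
  exact h u (huE (by simp)) v (huE (by simp)) huv

theorem WeaklyOrthSet.weaklyOrthKL {S : Finset (Fin n → ℚ_[p])} (h0 : 0 ∉ S)
    (hS : WeaklyOrthSet p S) (ℓ : ℕ) : WeaklyOrthKL p ℓ ℓ S :=
  ⟨h0, fun E hE hc => ⟨E, subset_rfl, hc, fun u hu v hv => hS u (hE hu) v (hE hv)⟩⟩

theorem WeaklyOrthSet.card_le_Delta {ℓ : ℕ} (hℓ : 2 ≤ ℓ) {S : Finset (Fin n → ℚ_[p])}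
    (h0 : 0 ∉ S) (hS : WeaklyOrthSet p S) : S.card ≤ Delta p n ℓ ℓ := by
  refine le_csSup ⟨max ℓ (Fintype.card (Fin n → ZMod p)), ?_⟩ ⟨S, hS.weaklyOrthKL h0 ℓ, rfl⟩
  rintro _ ⟨T, hT, rfl⟩
  rcases le_total T.card ℓ with h | h
  · exact le_max_of_le_left h
  · exact le_max_of_le_right ((hT.weaklyOrthSet hℓ h).card_le hT.1)

theorem orth2_single {i j : Fin n} (hij : i ≠ j) :
    Orth2 p (Pi.single i 1) (Pi.single j 1) := by
  intro a b
  have hs (k : Fin n) (c : ℚ_[p]) : c • (Pi.single k 1 : Fin n → ℚ_[p]) = Pi.single k c := by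
    rw [← Pi.single_smul', smul_eq_mul, mul_one]
  rw [hs, hs, Pi.norm_single, Pi.norm_single]
  refine le_antisymm ((pi_norm_le_iff_of_nonneg (by positivity)).2 fun k => ?_) (max_le ?_ ?_)
  · by_cases hi : k = i
    · subst hi; simp [hij]
    · by_cases hj : k = j
      · subst hj; simp [hi]
      · simp [hi, hj]
  · refine le_of_eq_of_le ?_ (norm_le_pi_norm _ i)
    simp [hij]
  · refine le_of_eq_of_le ?_ (norm_le_pi_norm _ j)
    simp [hij.symm]

theorem le_Delta {ℓ : ℕ} (hℓ : 2 ≤ ℓ) : n ≤ Delta p n ℓ ℓ := by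
  classical
  have hinj : Function.Injective fun i : Fin n => (Pi.single i 1 : Fin n → ℚ_[p]) :=
    fun i j h => by
      by_contra hij
      simpa [hij] using congrFun h i
  have h := WeaklyOrthSet.card_le_Delta (p := p) hℓ
    (S := Finset.univ.image fun i : Fin n => (Pi.single i 1 : Fin n → ℚ_[p]))
    (by simp) (by
      simp only [WeaklyOrthSet, Finset.mem_image, Finset.mem_univ, true_and]
      rintro _ ⟨i, rfl⟩ _ ⟨j, rfl⟩ hij
      exact orth2_single fun h => hij (by rw [h]))
  simpa [Finset.card_image_of_injective _ hinj] using h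

theorem OrthKL.exists_orthSet {ℓ : ℕ} {S : Finset (Fin n → ℚ_[p])} (hS : OrthKL p ℓ ℓ S)
    (hc : ℓ ≤ S.card) {T : Finset (Fin n → ℚ_[p])} (hT : T ⊆ S) (hTc : T.card ≤ ℓ) :
    OrthSet p T := by
  obtain ⟨E, hTE, hES, hE⟩ := Finset.exists_subsuperset_card_eq hT hTc hc
  obtain ⟨F, hFE, hF, h⟩ := hS.2 E hES hE
  obtain rfl := Finset.eq_of_subset_of_card_le hFE (by omega)
  exact h.subset hTE

theorem OrthKL.card_lt_Delta {ℓ : ℕ} (hℓ : 3 ≤ ℓ) {S : Finset (Fin n → ℚ_[p])}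
    (hS : OrthKL p ℓ ℓ S) (hc : ℓ ≤ S.card) : S.card < Delta p n ℓ ℓ := by
  classical
  have htriple {u v x : Fin n → ℚ_[p]} (hu : u ∈ S) (hv : v ∈ S) (hx : x ∈ S) :
      OrthSet p {u, v, x} :=
    hS.exists_orthSet hc (by grind) (Finset.card_le_three.trans hℓ)
  have hpair {u v : Fin n → ℚ_[p]} (hu : u ∈ S) (hv : v ∈ S) (huv : u ≠ v) : Orth2 p u v :=
    (htriple hu hv hv).orth2_of_mem (by simp) (by simp) huv
  obtain ⟨u, hu, v, hv, huv⟩ := Finset.one_lt_card.1 (show 1 < S.card by omega)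
  obtain ⟨c, hcu⟩ := exists_smul_norm_eq_one (ne_of_mem_of_not_mem hu hS.1)
  obtain ⟨d, hdv⟩ := exists_smul_norm_eq_one (ne_of_mem_of_not_mem hv hS.1)
  have horth : ∀ x ∈ S, Orth2 p (c • u + d • v) x := by
    intro x hx
    by_cases hux : u = x
    · subst hux
      exact (hpair hu hv huv).add_smul_left (hcu.trans hdv.symm)
    by_cases hvx : v = x
    · subst hvx
      rw [add_comm]
      exact (hpair hv hu huv.symm).add_smul_left (hdv.trans hcu.symm)
    exact (htriple hu hv hx).orth2_add (by simp) (by simp) (by simp) huv hux hvx c d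
  have hw0 : c • u + d • v ≠ 0 := by
    rw [← norm_ne_zero_iff, hpair hu hv huv, hcu, hdv]
    norm_num
  have hwS : c • u + d • v ∉ S := fun h => (horth _ h).ne hw0 rfl
  have h := WeaklyOrthSet.card_le_Delta (p := p) (ℓ := ℓ) (by omega)
    (S := insert (c • u + d • v) S) (by simpa [hw0.symm] using hS.1) (by
      intro x hx y hy hxy
      rcases Finset.mem_insert.1 hx with rfl | hx <;> rcases Finset.mem_insert.1 hy with rfl | hy
      · exact absurd rfl hxy
      · exact horth y hy
      · exact (horth x hx).symm
      · exact hpair hx hy hxy)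
  rwa [Finset.card_insert_of_notMem hwS] at h

end UltrametricAux

theorem stmt9 (p : ℕ) [Fact p.Prime] (n ℓ : ℕ) (hℓ : 3 ≤ ℓ) (hℓn : ℓ ≤ n) :
    Theta p n ℓ ℓ < Delta p n ℓ ℓ := by
  have hn : n ≤ Delta p n ℓ ℓ := le_Delta (by omega)
  have h : Theta p n ℓ ℓ ≤ Delta p n ℓ ℓ - 1 := by
    refine csSup_le' ?_
    rintro _ ⟨S, hS, rfl⟩
    rcases lt_or_ge S.card ℓ with hc | hc
    · omega
    · have := hS.card_lt_Delta hℓ hc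
      omega
  omega
end

section
/- Let q be a prime power, 𝔽_q a finite field with q elements, and 2 ≤ k ≤ n. Then: (i) Ind_q(n,k,ℓ) = q^n − 1 for every 1 ≤ ℓ ≤ ⌊log_q k⌋ + 1; (ii) Ind_q(n,k,ℓ) > Ind_q(n,k,ℓ+1) for every ℓ with ⌊log_q k⌋ + 1 ≤ ℓ ≤ k − 1; and (iii) Ind_q(n,k,k) ≥ n + 1. In particular the sequence {Ind_q(n,k,ℓ)}_{ℓ=1}^{k} is constant equal to q^n−1 up to ℓ = ⌊log_q k⌋+1 and strictly decreasing afterwards. -/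
open Finset

theorem IndKL.mono {F : Type*} [Field F] {n k ℓ ℓ' : ℕ} {S : Finset (Fin n → F)}
    (h : IndKL F n k ℓ S) (hle : ℓ' ≤ ℓ) : IndKL F n k ℓ' S :=
  ⟨h.1, fun X hX hc => hle.trans (h.2 X hX hc)⟩

theorem card_le_of_zero_notMem {F : Type*} [Field F] [Fintype F] {n : ℕ}
    {S : Finset (Fin n → F)} (h : (0 : Fin n → F) ∉ S) :
    S.card ≤ Fintype.card F ^ n - 1 := by
  classical
  have h1 : S ⊆ Finset.univ.erase 0 := fun x hx =>
    Finset.mem_erase.2 ⟨fun h0 => h (h0 ▸ hx), Finset.mem_univ _⟩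
  simpa [Finset.card_erase_of_mem] using Finset.card_le_card h1

theorem bddAbove_card_indKL (F : Type*) [Field F] [Fintype F] (n k ℓ : ℕ) :
    BddAbove {m | ∃ S : Finset (Fin n → F), IndKL F n k ℓ S ∧ S.card = m} :=
  ⟨Fintype.card F ^ n - 1, by rintro _ ⟨S, hS, rfl⟩; exact card_le_of_zero_notMem hS.1⟩

theorem IndKL.card_le_indMax {F : Type*} [Field F] [Fintype F] {n k ℓ : ℕ}
    {S : Finset (Fin n → F)} (h : IndKL F n k ℓ S) : S.card ≤ IndMax F n k ℓ :=
  le_csSup (bddAbove_card_indKL F n k ℓ) ⟨S, h, rfl⟩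

theorem exists_indKL_card_eq_indMax (F : Type*) [Field F] [Fintype F] {n k : ℕ} (ℓ : ℕ)
    (hk : 0 < k) : ∃ S : Finset (Fin n → F), IndKL F n k ℓ S ∧ S.card = IndMax F n k ℓ := by
  have hempty : IndKL F n k ℓ ∅ := by
    refine ⟨by simp, fun X hX hc => ?_⟩
    rw [Finset.subset_empty.1 hX, Finset.card_empty] at hc
    omega
  have hne : {m | ∃ S : Finset (Fin n → F), IndKL F n k ℓ S ∧ S.card = m}.Nonempty :=
    ⟨0, ∅, hempty, rfl⟩
  exact Nat.sSup_mem hne (bddAbove_card_indKL F n k ℓ)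

/-- A finite set of nonzero vectors has fewer elements than its span. -/
theorem card_lt_pow_finrank_span {F : Type*} [Field F] [Fintype F] {n : ℕ}
    {X : Finset (Fin n → F)} (h : (0 : Fin n → F) ∉ X) :
    X.card < Fintype.card F ^
      Module.finrank F (Submodule.span F (X : Set (Fin n → F))) := by
  classical
  have hsub : insert 0 X ⊆
      Finset.univ.filter (· ∈ Submodule.span F (X : Set (Fin n → F))) := by
    intro x hx
    rcases Finset.mem_insert.1 hx with rfl | hx
    · simp
    · simpa using Submodule.subset_span (Finset.mem_coe.2 hx)
  have hle := Finset.card_le_card hsub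
  rwa [Finset.card_insert_of_notMem h, ← Fintype.card_subtype,
    Module.card_eq_pow_finrank (K := F)] at hle

/-- The standard basis together with the all-ones vector. -/
def basisWithOnes (F : Type*) [Field F] [DecidableEq F] (n : ℕ) : Finset (Fin n → F) :=
  insert (fun _ => 1) (Finset.univ.image fun i => Pi.single i 1)

theorem card_basisWithOnes (F : Type*) [Field F] [DecidableEq F] {n : ℕ} (hn : 2 ≤ n) :
    (basisWithOnes F n).card = n + 1 := by
  have hinj : Function.Injective fun i : Fin n => (Pi.single i 1 : Fin n → F) := by
    intro i j h
    by_contra hij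
    have := congrFun h i
    simp [hij] at this
  rw [basisWithOnes, Finset.card_insert_of_notMem, Finset.card_image_of_injective _ hinj,
    Finset.card_univ, Fintype.card_fin]
  intro h
  obtain ⟨i, -, hi⟩ := Finset.mem_image.1 h
  have : Nontrivial (Fin n) := Fin.nontrivial_iff_two_le.2 hn
  obtain ⟨j, hj⟩ := exists_ne i
  have := congrFun hi j
  simp [hj] at this

theorem indKL_basisWithOnes (F : Type*) [Field F] [DecidableEq F] {n k : ℕ} (hn : 2 ≤ n)
    (hkn : k ≤ n) : IndKL F n k k (basisWithOnes F n) := by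
  have hcard := card_basisWithOnes F hn
  have hbasis : LinearIndepOn F id
      (Set.range fun i : Fin n => (Pi.single i 1 : Fin n → F)) := by
    have := (Pi.basisFun F (Fin n)).linearIndependent.linearIndepOn_id
    rwa [show ⇑(Pi.basisFun F (Fin n)) = fun i => Pi.single i 1 from
      funext (Pi.basisFun_apply F (Fin n))] at this
  refine ⟨?_, fun X hX hc => ?_⟩
  · intro h
    have : Nonempty (Fin n) := ⟨⟨0, by omega⟩⟩
    rcases Finset.mem_insert.1 h with h | h
    · have := congrFun h (Classical.arbitrary _)
      simp at this
    · obtain ⟨i, -, hi⟩ := Finset.mem_image.1 h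
      simp at hi
  suffices hli : LinearIndepOn F id (X : Set (Fin n → F)) by
    have := finrank_span_finset_eq_card (R := F) (s := X) hli
    omega
  have hsub : ∀ x ∈ X, x ≠ (fun _ => 1) → ∃ i : Fin n, Pi.single i 1 = x := by
    intro x hx hne
    simpa [basisWithOnes, hne] using hX hx
  by_cases h1 : (fun _ => 1 : Fin n → F) ∈ X
  · rw [← Finset.insert_erase h1, Finset.coe_insert]
    refine LinearIndepOn.id_insert (hbasis.mono ?_) ?_
    · intro x hx
      obtain ⟨hne, hx⟩ := Finset.mem_erase.1 hx
      exact hsub x hx hne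
    · obtain ⟨i, hi⟩ : ∃ i : Fin n, (Pi.single i 1 : Fin n → F) ∉ X := by
        by_contra! hall
        have : basisWithOnes F n ⊆ X := by
          intro x hx
          rcases Finset.mem_insert.1 hx with rfl | hx
          · exact h1
          · obtain ⟨i, -, rfl⟩ := Finset.mem_image.1 hx
            exact hall i
        have := Finset.card_le_card this
        omega
      intro hmem
      have hle : Submodule.span F ((X.erase fun _ => 1 : Finset (Fin n → F)) : Set (Fin n → F)) ≤
          LinearMap.ker (LinearMap.proj (R := F) (φ := fun _ : Fin n => F) i) := by
        refine Submodule.span_le.2 fun x hx => ?_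
        obtain ⟨hne, hx⟩ := Finset.mem_erase.1 hx
        obtain ⟨j, rfl⟩ := hsub x hx hne
        have hij : i ≠ j := by rintro rfl; exact hi hx
        simp [hij]
      simpa using hle hmem
  · exact hbasis.mono fun x hx => hsub x hx fun h => h1 (h ▸ hx)

theorem succ_le_indMax (F : Type*) [Field F] [Fintype F] {n k ℓ : ℕ} (hn : 2 ≤ n)
    (hkn : k ≤ n) (hℓ : ℓ ≤ k) : n + 1 ≤ IndMax F n k ℓ := by
  classical
  rw [← card_basisWithOnes F hn]
  exact ((indKL_basisWithOnes F hn hkn).mono hℓ).card_le_indMax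

/-- Adding one nonzero vector to a large enough independent set lowers `ℓ` by at most one. -/
theorem IndKL.insert_of_ne_zero {F : Type*} [Field F] [DecidableEq F] {n k ℓ : ℕ} {S : Finset (Fin n → F)}
    (h : IndKL F n k (ℓ + 1) S) (hS : k ≤ S.card) {v : Fin n → F} (hv : v ≠ 0) :
    IndKL F n k ℓ (insert v S) := by
  refine ⟨fun h0 => ?_, fun X hX hc => ?_⟩
  · rcases Finset.mem_insert.1 h0 with h0 | h0
    exacts [hv h0.symm, h.1 h0]
  by_cases hvX : v ∈ X
  · have hsub : X.erase v ⊆ S := Finset.subset_insert_iff.1 hX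
    obtain ⟨Y, hXY, hYS, hY⟩ := Finset.exists_subsuperset_card_eq hsub
      ((Finset.card_le_card (Finset.erase_subset v X)).trans hc.le) hS
    have hdiff : (Y \ X.erase v).card = 1 := by
      have := Finset.card_pos.2 ⟨v, hvX⟩
      rw [Finset.card_sdiff_of_subset hXY, Finset.card_erase_of_mem hvX]
      omega
    have hdim := h.2 Y hYS hY
    have hspan : Submodule.span F (Y : Set (Fin n → F)) ≤
        Submodule.span F (X : Set (Fin n → F)) ⊔
          Submodule.span F ((Y \ X.erase v : Finset (Fin n → F)) : Set (Fin n → F)) := by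
      rw [← Submodule.span_union, ← Finset.coe_union]
      refine Submodule.span_mono fun y hy => ?_
      have hy : y ∈ Y := hy
      by_cases hyX : y ∈ X.erase v
      · simp [Finset.mem_of_mem_erase hyX]
      · exact Finset.mem_union_right _ (Finset.mem_sdiff.2 ⟨hy, hyX⟩)
    have h1 := Submodule.finrank_mono hspan
    have h2 := Submodule.finrank_add_le_finrank_add_finrank
      (Submodule.span F (X : Set (Fin n → F)))
      (Submodule.span F ((Y \ X.erase v : Finset (Fin n → F)) : Set (Fin n → F)))
    have h3 := finrank_span_finset_le_card (R := F) (Y \ X.erase v)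
    rw [Set.finrank] at h3
    omega
  · have := h.2 X ((Finset.subset_insert_iff_of_notMem hvX).1 hX) hc
    omega

/-- If `k < q ^ ℓ`, some subspace of dimension `ℓ` contains `k` nonzero vectors, so a
`(k, ℓ + 1)`-independent set misses some nonzero vector. -/
theorem IndKL.exists_ne_zero_notMem {F : Type*} [Field F] [Fintype F] {n k ℓ : ℕ}
    {S : Finset (Fin n → F)} (h : IndKL F n k (ℓ + 1) S) (hℓ : ℓ ≤ n)
    (hk : k < Fintype.card F ^ ℓ) : ∃ v, v ≠ 0 ∧ v ∉ S := by
  classical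
  by_contra! hall
  obtain ⟨W, hW⟩ : ∃ W : Submodule F (Fin n → F), Module.finrank F W = ℓ := by
    obtain ⟨B, hB, hli⟩ := exists_finset_linearIndependent_of_le_finrank (R := F)
      (M := Fin n → F) (n := ℓ) (by simpa using hℓ)
    exact ⟨Submodule.span F B, (finrank_span_finset_eq_card hli).trans hB⟩
  have hcW : (Finset.univ.filter (· ∈ W)).card = Fintype.card F ^ ℓ := by
    rw [← hW, ← Module.card_eq_pow_finrank, Fintype.card_subtype]
  have hle : k ≤ ((Finset.univ.filter (· ∈ W)).erase 0).card := by
    rw [Finset.card_erase_of_mem (by simp)]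
    omega
  obtain ⟨X, hX, hc⟩ := Finset.exists_subset_card_eq hle
  have hdim := h.2 X (fun x hx => hall x (Finset.ne_of_mem_erase (hX hx))) hc
  have hXW : Submodule.span F (X : Set (Fin n → F)) ≤ W :=
    Submodule.span_le.2 fun x hx => by simpa using Finset.mem_of_mem_erase (hX hx)
  have := Submodule.finrank_mono hXW
  omega

theorem stmt13 (q : ℕ) (hq : IsPrimePow q) (F : Type*) [Field F] [Fintype F]
    (hF : Fintype.card F = q) (n k : ℕ) (hk2 : 2 ≤ k) (hkn : k ≤ n) :
    (∀ ℓ : ℕ, 1 ≤ ℓ → ℓ ≤ Nat.log q k + 1 → IndMax F n k ℓ = q ^ n - 1) ∧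
    (∀ ℓ : ℕ, Nat.log q k + 1 ≤ ℓ → ℓ ≤ k - 1 →
      IndMax F n k (ℓ + 1) < IndMax F n k ℓ) ∧
    n + 1 ≤ IndMax F n k k := by
  classical
  have hq1 : 1 < q := hq.one_lt
  subst hF
  refine ⟨fun ℓ _ hℓ => le_antisymm ?_ ?_, fun ℓ hℓ hℓk => ?_,
    succ_le_indMax F (hk2.trans hkn) hkn le_rfl⟩
  · obtain ⟨S, hS, hc⟩ := exists_indKL_card_eq_indMax F (n := n) (k := k) ℓ (by omega)
    exact hc ▸ card_le_of_zero_notMem hS.1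
  · have hS : IndKL F n k ℓ (Finset.univ.erase 0) := by
      refine ⟨by simp, fun X hX hc => hℓ.trans ?_⟩
      have := card_lt_pow_finrank_span fun h0 => by simpa using hX h0
      rw [hc] at this
      exact Nat.log_lt_of_lt_pow (by omega) this
    simpa [Finset.card_erase_of_mem] using hS.card_le_indMax
  · obtain ⟨S, hS, hc⟩ := exists_indKL_card_eq_indMax F (n := n) (k := k) (ℓ + 1) (by omega)
    have hlarge : n + 1 ≤ IndMax F n k (ℓ + 1) :=
      succ_le_indMax F (hk2.trans hkn) hkn (by omega)
    obtain ⟨v, hv0, hvS⟩ := hS.exists_ne_zero_notMem (by omega)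
      ((Nat.lt_pow_succ_log_self hq1 k).trans_le (Nat.pow_le_pow_right (by omega) hℓ))
    have := (hS.insert_of_ne_zero (by omega) hv0).card_le_indMax
    rw [Finset.card_insert_of_notMem hvS] at this
    omega
end
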